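/- For every n ≥ 3 and every permutation p ∈ B_1(n) (i.e., rank(p) = 1), the number of permutations q ∈ B_3(n) with p ≼ q equals C(n−1, 2). -/

import Mathlib

/-- The inversion set of a permutation `p` of `{0,…,n-1}` (0-indexed version of
`Inv(p) = {(p_j, p_i) : i < j, p_j < p_i}`): pairs `(a, b)` of values with `a < b`
such that `b` precedes `a` in the one-line notation of `p`. -/
def InvSet (n : ℕ) (p : Equiv.Perm (Fin n)) : Finset (Fin n × Fin n) :=
  Finset.univ.filter (fun x => x.1 < x.2 ∧ p.symm x.2 < p.symm x.1)

/-- The weak (right) Bruhat order: `p ≼ q` iff `Inv(p) ⊆ Inv(q)`. -/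
def BLE {n : ℕ} (p q : Equiv.Perm (Fin n)) : Prop :=
  InvSet n p ⊆ InvSet n q

/-- The rank of a permutation in the weak Bruhat order: `rank(p) = |Inv(p)|`. -/
def brank (n : ℕ) (p : Equiv.Perm (Fin n)) : ℕ :=
  (InvSet n p).card

/-- The inverse descent set `ID(p) ⊆ {1,…,n-1}`: `i ∈ ID(p)` iff the (1-indexed)
value `i+1` precedes the value `i` in the one-line notation of `p`.  Here the
1-indexed value `v ∈ {1,…,n}` corresponds to the element of `Fin n` with `val = v - 1`. -/
def ID (n : ℕ) (p : Equiv.Perm (Fin n)) : Finset ℕ :=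
  (Finset.Icc 1 (n - 1)).filter
    (fun i => ∃ a b : Fin n, (a : ℕ) + 1 = i ∧ (b : ℕ) = i ∧ p.symm b < p.symm a)

/-- The generator `g i` is the adjacent transposition interchanging the
(1-indexed) values `i` and `i+1`. -/
def g (n i : ℕ) : Equiv.Perm (Fin n) :=
  if h : 1 ≤ i ∧ i < n then Equiv.swap ⟨i - 1, by omega⟩ ⟨i, h.2⟩ else 1

/-- A family of permutations is intersecting if any two of its members have
meet different from the identity in the weak Bruhat lattice; equivalently (since the
identity is the minimum), any two members have a common lower bound distinct
from the identity. -/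
def BInter (n : ℕ) (P : Set (Equiv.Perm (Fin n))) : Prop :=
  ∀ p ∈ P, ∀ q ∈ P, ∃ r : Equiv.Perm (Fin n), r ≠ 1 ∧ BLE r p ∧ BLE r q

/-- A maximal intersecting family: intersecting, and every permutation
intersecting all its members belongs to it. -/
def MaxBInter (n : ℕ) (P : Set (Equiv.Perm (Fin n))) : Prop :=
  BInter n P ∧ ∀ q : Equiv.Perm (Fin n),
    (∀ p ∈ P, ∃ r : Equiv.Perm (Fin n), r ≠ 1 ∧ BLE r q ∧ BLE r p) → q ∈ P

/-- The set of `≼`-minimal elements of a family `P`. -/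
def minSet (n : ℕ) (P : Set (Equiv.Perm (Fin n))) : Set (Equiv.Perm (Fin n)) :=
  {p | p ∈ P ∧ ∀ q ∈ P, BLE q p → q = p}

/-- `m` is the meet (greatest lower bound) of `p` and `q` in the weak Bruhat order. -/
def IsMeetB (n : ℕ) (p q m : Equiv.Perm (Fin n)) : Prop :=
  BLE m p ∧ BLE m q ∧ ∀ r, BLE r p → BLE r q → BLE r m

/-- `m` is the join (least upper bound) of the set `S` in the weak Bruhat order. -/
def IsLUBB (n : ℕ) (S : Set (Equiv.Perm (Fin n))) (m : Equiv.Perm (Fin n)) : Prop :=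
  (∀ s ∈ S, BLE s m) ∧ ∀ u, (∀ s ∈ S, BLE s u) → BLE m u

/-- For a system `𝒜` of subsets of `{1,…,n-1}`,
`P(𝒜) = {p : A ⊆ ID(p) for some A ∈ 𝒜}`. -/
def PofSystem (n : ℕ) (𝒜 : Set (Finset ℕ)) : Set (Equiv.Perm (Fin n)) :=
  {p | ∃ A ∈ 𝒜, A ⊆ ID n p}

/-- The generating set system of a family `P`: `{ID(p) : p ∈ min(P)}`. -/
def genSys (n : ℕ) (P : Set (Equiv.Perm (Fin n))) : Set (Finset ℕ) :=
  {A | ∃ p ∈ minSet n P, ID n p = A}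

/-- A maximal intersecting antichain of subsets of `{1,…,n-1}`: an antichain
under inclusion, any two members of which meet, such that for every subset `B`
of `{1,…,n-1}` not in the system there is a member `A` with `A ∩ B = ∅` or `A ⊆ B`. -/
def MIA (n : ℕ) (𝒜 : Set (Finset ℕ)) : Prop :=
  (∀ A ∈ 𝒜, ∀ B ∈ 𝒜, A ⊆ B → A = B) ∧
  (∀ A ∈ 𝒜, ∀ B ∈ 𝒜, (A ∩ B).Nonempty) ∧
  (∀ B : Finset ℕ, B ⊆ Finset.Icc 1 (n - 1) → B ∉ 𝒜 → ∃ A ∈ 𝒜, A ∩ B = ∅ ∨ A ⊆ B)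

open Finset

/-- The number of inversions of `σ`, viewed as a word `σ 0, …, σ (n - 1)`. -/
def invCount {n : ℕ} (σ : Equiv.Perm (Fin n)) : ℕ :=
  (univ.filter (fun x : Fin n × Fin n => x.1 < x.2 ∧ σ x.2 < σ x.1)).card

/-- The permutation whose word starts with `x.1` and continues with a word order-isomorphic
to `x.2`. -/
def consPerm {n : ℕ} (x : Fin (n + 1) × Equiv.Perm (Fin n)) : Equiv.Perm (Fin (n + 1)) :=
  x.1.cycleRange.symm * Equiv.Perm.decomposeFin.symm (0, x.2)

lemma consPerm_zero {n : ℕ} (x : Fin (n + 1) × Equiv.Perm (Fin n)) :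
    consPerm x 0 = x.1 := by
  simp [consPerm, Fin.cycleRange_symm_zero]

lemma consPerm_succ {n : ℕ} (x : Fin (n + 1) × Equiv.Perm (Fin n)) (i : Fin n) :
    consPerm x i.succ = x.1.succAbove (x.2 i) := by
  simp [consPerm, Fin.cycleRange_symm_succ]

lemma consPerm_bijective (n : ℕ) : Function.Bijective (consPerm (n := n)) := by
  rw [Fintype.bijective_iff_injective_and_card]
  refine ⟨?_, by simp [Fintype.card_perm, Nat.factorial_succ]⟩
  rintro ⟨v, τ⟩ ⟨w, ρ⟩ h
  have hv : v = w := by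
    have := congrArg (fun σ : Equiv.Perm (Fin (n + 1)) => σ 0) h
    simpa only [consPerm_zero] using this
  subst hv
  refine Prod.ext rfl (Equiv.ext fun i => ?_)
  have := congrArg (fun σ : Equiv.Perm (Fin (n + 1)) => σ i.succ) h
  simpa only [consPerm_succ, Fin.succAbove_right_inj] using this

lemma invCount_eq_sum {n : ℕ} (σ : Equiv.Perm (Fin n)) :
    invCount σ = ∑ i, ∑ j, if i < j ∧ σ j < σ i then 1 else 0 := by
  rw [invCount, card_filter, Fintype.sum_prod_type]

lemma sum_succAbove_lt {n : ℕ} (v : Fin (n + 1)) :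
    (∑ j : Fin n, if v.succAbove j < v then 1 else 0) = (v : ℕ) := by
  have h := Fin.sum_univ_succAbove (fun j : Fin (n + 1) => if j < v then 1 else 0) v
  simp only [lt_irrefl, if_false, zero_add] at h
  rw [← h, ← card_filter, filter_gt_eq_Iio, Fin.card_Iio]

lemma invCount_consPerm {n : ℕ} (x : Fin (n + 1) × Equiv.Perm (Fin n)) :
    invCount (consPerm x) = x.1 + invCount x.2 := by
  rw [invCount_eq_sum, invCount_eq_sum, Fin.sum_univ_succ]
  congr 1
  · rw [Fin.sum_univ_succ]
    simp only [lt_irrefl, false_and, if_false, zero_add, consPerm_zero, consPerm_succ,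
      Fin.succ_pos, true_and]
    rw [Equiv.sum_comp x.2 (fun j => if x.1.succAbove j < x.1 then 1 else 0)]
    exact sum_succAbove_lt x.1
  · refine sum_congr rfl fun i _ => ?_
    rw [Fin.sum_univ_succ]
    simp [consPerm_succ]

/-- The number of permutations of `Fin n` with `k` inversions. -/
def mahonian (n k : ℕ) : ℕ :=
  (univ.filter (fun σ : Equiv.Perm (Fin n) => invCount σ = k)).card

lemma mahonian_succ (n k : ℕ) :
    mahonian (n + 1) k =
      ∑ v : Fin (n + 1), ∑ τ : Equiv.Perm (Fin n), if (v : ℕ) + invCount τ = k then 1 else 0 := by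
  rw [mahonian, card_filter, ← Fintype.sum_prod_type',
    ← (Equiv.ofBijective _ (consPerm_bijective n)).sum_comp]
  simp [invCount_consPerm]

lemma mahonian_succ_zero (n : ℕ) : mahonian (n + 1) 0 = mahonian n 0 := by
  rw [mahonian_succ, Fin.sum_univ_succ]
  simp [mahonian]

lemma mahonian_succ_one (n : ℕ) :
    mahonian (n + 2) 1 = mahonian (n + 1) 1 + mahonian (n + 1) 0 := by
  rw [mahonian_succ, Fin.sum_univ_succ, Fin.sum_univ_succ]
  have h (i : Fin n) (τ : Equiv.Perm (Fin (n + 1))) :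
      ¬ ((i.succ.succ : Fin (n + 2)) : ℕ) + invCount τ = 1 := by
    simp only [Fin.val_succ]; omega
  simp only [h, mahonian, card_filter]
  simp [add_comm 1]

lemma mahonian_succ_two (n : ℕ) :
    mahonian (n + 3) 2 = mahonian (n + 2) 2 + mahonian (n + 2) 1 + mahonian (n + 2) 0 := by
  rw [mahonian_succ, Fin.sum_univ_succ, Fin.sum_univ_succ, Fin.sum_univ_succ]
  have h (i : Fin n) (τ : Equiv.Perm (Fin (n + 2))) :
      ¬ ((i.succ.succ.succ : Fin (n + 3)) : ℕ) + invCount τ = 2 := by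
    simp only [Fin.val_succ]; omega
  have h1 (m : ℕ) : 1 + m = 2 ↔ m = 1 := by omega
  have h2 (m : ℕ) : 2 + m = 2 ↔ m = 0 := by omega
  have h3 : (((0 : Fin (n + 1)).succ.succ : Fin (n + 3)) : ℕ) = 2 := rfl
  simp only [h, h3, h2, mahonian, card_filter]
  simp [h1, add_assoc]

lemma mahonian_zero_right (n : ℕ) : mahonian n 0 = 1 := by
  induction n with
  | zero => decide
  | succ n ih => rw [mahonian_succ_zero, ih]

lemma mahonian_one_right (n : ℕ) : mahonian (n + 1) 1 = n := by
  induction n with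
  | zero => decide
  | succ n ih => rw [mahonian_succ_one, ih, mahonian_zero_right]

lemma mahonian_two_right (n : ℕ) : mahonian (n + 2) 2 = (n + 1).choose 2 + n := by
  induction n with
  | zero => decide
  | succ n ih =>
    rw [mahonian_succ_two, ih, mahonian_zero_right, mahonian_one_right,
      Nat.choose_succ_succ' (n + 1) 1, Nat.choose_one_right]
    simp only [Nat.reduceAdd]
    omega

lemma card_filter_brank (n k : ℕ) :
    (univ.filter (fun q : Equiv.Perm (Fin n) => brank n q = k)).card = mahonian n k :=
  card_bij' (fun q _ => q.symm) (fun q _ => q.symm)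
    (fun _ hq => mem_filter.2 ⟨mem_univ _, (mem_filter.1 hq).2⟩)
    (fun _ hq => mem_filter.2 ⟨mem_univ _, (mem_filter.1 hq).2⟩)
    (fun _ _ => rfl) (fun _ _ => rfl)

lemma mem_InvSet {n : ℕ} {p : Equiv.Perm (Fin n)} {a b : Fin n} :
    (a, b) ∈ InvSet n p ↔ a < b ∧ p.symm b < p.symm a := by
  simp [InvSet]

section Swap

variable {n : ℕ} {a b : Fin n}

lemma swap_lt_swap (hab : (b : ℕ) = a + 1) {x y : Fin n} (hxy : x < y)
    (hne : (x, y) ≠ (a, b)) : Equiv.swap a b x < Equiv.swap a b y := by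
  simp only [ne_eq, Prod.mk.injEq, not_and] at hne
  simp only [Equiv.swap_apply_def]
  grind

lemma mem_InvSet_swap_mul (hab : (b : ℕ) = a + 1) (q : Equiv.Perm (Fin n)) :
    (a, b) ∈ InvSet n (Equiv.swap a b * q) ↔ (a, b) ∉ InvSet n q := by
  have hlt : a < b := by rw [Fin.lt_def]; omega
  have hne : q.symm a ≠ q.symm b := fun h => hlt.ne (q.symm.injective h)
  have hs (x : Fin n) : (Equiv.swap a b * q).symm x = q.symm (Equiv.swap a b x) := rfl
  rw [mem_InvSet, mem_InvSet, hs, hs, Equiv.swap_apply_left, Equiv.swap_apply_right]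
  grind

lemma card_InvSet_swap_mul_erase (hab : (b : ℕ) = a + 1) (q : Equiv.Perm (Fin n)) :
    ((InvSet n (Equiv.swap a b * q)).erase (a, b)).card = ((InvSet n q).erase (a, b)).card := by
  have hs (q : Equiv.Perm (Fin n)) (x : Fin n) :
      (Equiv.swap a b * q).symm x = q.symm (Equiv.swap a b x) := rfl
  have key (q : Equiv.Perm (Fin n)) (x : Fin n × Fin n)
      (hx : x ∈ (InvSet n (Equiv.swap a b * q)).erase (a, b)) :
      (Equiv.swap a b x.1, Equiv.swap a b x.2) ∈ (InvSet n q).erase (a, b) := by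
    obtain ⟨x, y⟩ := x
    rw [mem_erase, mem_InvSet, hs, hs] at hx
    rw [mem_erase, mem_InvSet]
    refine ⟨fun h => ?_, swap_lt_swap hab hx.2.1 hx.1, hx.2.2⟩
    simp only [Prod.mk.injEq, Equiv.swap_apply_eq_iff, Equiv.swap_apply_left,
      Equiv.swap_apply_right] at h
    have := hx.2.1
    rw [h.1, h.2, Fin.lt_def] at this
    omega
  refine card_bij' (fun x _ => (Equiv.swap a b x.1, Equiv.swap a b x.2))
    (fun x _ => (Equiv.swap a b x.1, Equiv.swap a b x.2)) (key q) (fun x hx => key _ x ?_)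
    (fun _ _ => by simp) (fun _ _ => by simp)
  rwa [Equiv.swap_mul_self_mul]

lemma brank_swap_mul (hab : (b : ℕ) = a + 1) {q : Equiv.Perm (Fin n)}
    (hq : (a, b) ∉ InvSet n q) : brank n (Equiv.swap a b * q) = brank n q + 1 := by
  have h := card_InvSet_swap_mul_erase hab q
  rw [erase_eq_of_notMem hq] at h
  rw [brank, brank, ← h, card_erase_add_one ((mem_InvSet_swap_mul hab q).2 hq)]

lemma card_rank_succ_mem_InvSet (hab : (b : ℕ) = a + 1) (k : ℕ) :
    (univ.filter (fun q : Equiv.Perm (Fin n) => brank n q = k + 1 ∧ (a, b) ∈ InvSet n q)).card =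
      (univ.filter (fun q : Equiv.Perm (Fin n) => brank n q = k ∧ (a, b) ∉ InvSet n q)).card := by
  refine card_bij' (fun q _ => Equiv.swap a b * q) (fun q _ => Equiv.swap a b * q) ?_ ?_
    (fun q _ => Equiv.swap_mul_self_mul a b q) (fun q _ => Equiv.swap_mul_self_mul a b q)
  · intro q hq
    simp only [mem_filter, mem_univ, true_and] at hq ⊢
    have hn : (a, b) ∉ InvSet n (Equiv.swap a b * q) := by
      rw [mem_InvSet_swap_mul hab]; exact not_not.2 hq.2
    have h := brank_swap_mul hab hn
    rw [Equiv.swap_mul_self_mul] at h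
    exact ⟨by omega, hn⟩
  · intro q hq
    simp only [mem_filter, mem_univ, true_and] at hq ⊢
    exact ⟨by rw [brank_swap_mul hab hq.2, hq.1], (mem_InvSet_swap_mul hab q).2 hq.2⟩

lemma card_rank_succ_mem_InvSet_add (hab : (b : ℕ) = a + 1) (k : ℕ) :
    (univ.filter (fun q : Equiv.Perm (Fin n) => brank n q = k + 1 ∧ (a, b) ∈ InvSet n q)).card +
      (univ.filter (fun q : Equiv.Perm (Fin n) => brank n q = k ∧ (a, b) ∈ InvSet n q)).card =
      mahonian n k := by
  rw [card_rank_succ_mem_InvSet hab, ← card_filter_brank, add_comm, ← filter_filter,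
    ← filter_filter, card_filter_add_card_filter_not]

end Swap

lemma exists_InvSet_eq_singleton {n : ℕ} {p : Equiv.Perm (Fin n)} (hp : brank n p = 1) :
    ∃ a b : Fin n, (b : ℕ) = a + 1 ∧ InvSet n p = {(a, b)} := by
  obtain ⟨⟨a, b⟩, h⟩ := card_eq_one.1 hp
  refine ⟨a, b, ?_, h⟩
  have hmem : (a, b) ∈ InvSet n p := by simp [h]
  rw [mem_InvSet] at hmem
  by_contra hne
  have hlt := Fin.lt_def.1 hmem.1
  obtain ⟨c, hac, hcb⟩ : ∃ c : Fin n, a < c ∧ c < b :=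
    ⟨⟨a + 1, by omega⟩, by rw [Fin.lt_def]; simp, by rw [Fin.lt_def]; simp; omega⟩
  rcases lt_or_ge (p.symm c) (p.symm a) with hc | hc
  · have : (a, c) ∈ InvSet n p := mem_InvSet.2 ⟨hac, hc⟩
    rw [h, mem_singleton, Prod.mk.injEq] at this
    exact hcb.ne this.2
  · have : (c, b) ∈ InvSet n p := mem_InvSet.2 ⟨hcb, hmem.2.trans_le hc⟩
    rw [h, mem_singleton, Prod.mk.injEq] at this
    exact hac.ne' this.1

/-- For `n ≥ 3` and any rank-1 permutation `p`, the number of rank-3 permutations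
above `p` in the weak Bruhat order is `C(n-1, 2)`. -/
theorem stmt_15 (n : ℕ) (hn : 3 ≤ n) (p : Equiv.Perm (Fin n)) (hp : brank n p = 1) :
    Nat.card {q : Equiv.Perm (Fin n) | brank n q = 3 ∧ BLE p q} =
      Nat.choose (n - 1) 2 := by
  obtain ⟨a, b, hab, h⟩ := exists_InvSet_eq_singleton hp
  have hcard : Nat.card {q : Equiv.Perm (Fin n) | brank n q = 3 ∧ BLE p q} =
      (univ.filter (fun q : Equiv.Perm (Fin n) => brank n q = 3 ∧ (a, b) ∈ InvSet n q)).card := by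
    simp [BLE, h, Fintype.card_subtype]
  have h0 : (univ.filter
      (fun q : Equiv.Perm (Fin n) => brank n q = 0 ∧ (a, b) ∈ InvSet n q)).card = 0 := by
    rw [card_eq_zero, filter_eq_empty_iff]
    rintro q - ⟨hq, hmem⟩
    exact card_ne_zero_of_mem hmem hq
  have h1 := card_rank_succ_mem_InvSet_add hab 0
  have h2 := card_rank_succ_mem_InvSet_add hab 1
  have h3 := card_rank_succ_mem_InvSet_add hab 2
  obtain ⟨m, rfl⟩ : ∃ m, n = m + 2 := ⟨n - 2, by omega⟩
  rw [mahonian_zero_right] at h1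
  rw [mahonian_one_right] at h2
  rw [mahonian_two_right] at h3
  rw [hcard, show m + 2 - 1 = m + 1 by omega]
  simp only [zero_add, Nat.reduceAdd] at h1 h2 h3
  omega
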